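/- Let n be an even positive integer and k ≥ 1 an integer. Let cOpt, cOpt' : ZMod n → Bool be colorings with d_H(cOpt, cOpt') = 1 and |CE(cOpt')| = |CE(cOpt)| + 2 (OPT recolors a single node and thereby introduces two new adjacent cut-edges). Let cOff : ZMod n → Bool satisfy CE(cOff) ⊆ CE(cOpt) and |CE(cOff)| = min(2k, |CE(cOpt)|). Then there exists a coloring cOff' : ZMod n → Bool such that CE(cOff') ⊆ CE(cOpt'), |CE(cOff')| = min(2k, |CE(cOpt')|), and d_H(cOff, cOff') + φ(cOpt', cOff') ≤ 1 + φ(cOpt, cOff). -/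

import Mathlib

/-- The cut-edge set of a coloring `c` of the ring `ZMod n`. -/
def CE {n : ℕ} (c : ZMod n → Bool) : Set (ZMod n) := {i | c i ≠ c (i + 1)}

/-- Hamming distance between two colorings of `ZMod n`. -/
noncomputable def hamDist {n : ℕ} (c c' : ZMod n → Bool) : ℕ :=
  {i : ZMod n | c i ≠ c' i}.ncard

/-- The potential: distance from the coloring of OPT to the nearer of the two
colorings of OFF (up to a swap of color names). -/
noncomputable def pot (n : ℕ) (c c' : ZMod n → Bool) : ℕ :=
  min (hamDist c c') (n - hamDist c c')

lemma hamDist_self {n : ℕ} (c : ZMod n → Bool) : hamDist c c = 0 := by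
  simp [hamDist]

lemma hamDist_comm {n : ℕ} (a b : ZMod n → Bool) : hamDist a b = hamDist b a := by
  simp only [hamDist, ne_comm]

lemma hamDist_triangle {n : ℕ} [NeZero n] (a b c : ZMod n → Bool) :
    hamDist a c ≤ hamDist a b + hamDist b c := by
  refine (Set.ncard_le_ncard (fun i hi => ?_) (Set.toFinite _)).trans (Set.ncard_union_le _ _)
  by_contra h
  simp only [Set.mem_union, Set.mem_ofPred_eq, not_or, not_not] at h hi
  exact hi (h.1.trans h.2)

lemma hamDist_not_right {n : ℕ} (c : ZMod n → Bool) : hamDist c (fun i => !c i) = n := by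
  simp [hamDist]

lemma hamDist_not_not {n : ℕ} (a b : ZMod n → Bool) :
    hamDist (fun i => !a i) (fun i => !b i) = hamDist a b := by
  simp [hamDist]

lemma CE_not {n : ℕ} (c : ZMod n → Bool) : CE (fun i => !c i) = CE c := by
  simp [CE]

/-- The potential is 1-Lipschitz in its first argument. -/
lemma pot_le_hamDist_add_pot {n : ℕ} [NeZero n] (a a' b : ZMod n → Bool) :
    pot n a' b ≤ hamDist a a' + pot n a b := by
  have h₁ := hamDist_triangle a' a b
  have h₂ := hamDist_triangle a a' b
  rw [hamDist_comm a' a] at h₁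
  unfold pot
  omega

/-- A coloring of the ring has an even number of cut-edges. -/
lemma even_ncard_CE {n : ℕ} [NeZero n] (c : ZMod n → Bool) : Even (CE c).ncard := by
  classical
  let f : ZMod n → ZMod 2 := fun i => if c i then 1 else 0
  have hterm (i : ZMod n) : (if i ∈ CE c then (1 : ZMod 2) else 0) = f i + f (i + 1) := by
    simp only [CE, Set.mem_ofPred_eq, f]
    rcases Bool.eq_false_or_eq_true (c i) with hi | hi <;>
      rcases Bool.eq_false_or_eq_true (c (i + 1)) with hj | hj <;>
      simp [hi, hj, CharTwo.add_self_eq_zero]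
  have hsum : ∑ i, f (i + 1) = ∑ i, f i := Equiv.sum_comp (Equiv.addRight 1) f
  rw [← ZMod.natCast_eq_zero_iff_even, Set.ncard_eq_toFinset_card',
    ← Set.filter_mem_univ_eq_toFinset, ← Finset.sum_boole, Finset.sum_congr rfl fun i _ => hterm i,
    Finset.sum_add_distrib, hsum]
  exact CharTwo.add_self_eq_zero _

lemma apply_eq_apply_zero_of_apply_add_one {n : ℕ} [NeZero n] {α : Type*} {d : ZMod n → α}
    (h : ∀ i, d (i + 1) = d i) (i : ZMod n) : d i = d 0 := by
  have hnat (m : ℕ) : d m = d 0 := by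
    induction m with
    | zero => simp
    | succ m ih => rw [Nat.cast_succ, h, ih]
  simpa using hnat i.val

/-- The cut-edges determine a coloring up to a swap of the color names. -/
lemma eq_or_eq_not_of_CE_eq {n : ℕ} [NeZero n] {a b : ZMod n → Bool} (h : CE a = CE b) :
    a = b ∨ a = fun i => !b i := by
  have hstep (i : ZMod n) : xor (a (i + 1)) (b (i + 1)) = xor (a i) (b i) := by
    have hi := Set.ext_iff.mp h i
    simp only [CE, Set.mem_ofPred_eq] at hi
    revert hi
    cases a i <;> cases a (i + 1) <;> cases b i <;> cases b (i + 1) <;> decide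
  have hconst := apply_eq_apply_zero_of_apply_add_one (d := fun i => xor (a i) (b i)) hstep
  cases h0 : xor (a 0) (b 0)
  · left
    funext i
    simpa [h0] using hconst i
  · right
    funext i
    have := hconst i
    rw [h0] at this
    revert this
    cases a i <;> cases b i <;> decide

/-- If recoloring one node adds two cut-edges, then no cut-edge is lost. -/
lemma CE_subset_of_ncard_eq_add_two {n : ℕ} [NeZero n] {a b : ZMod n → Bool}
    (hdist : hamDist a b = 1) (hcard : (CE b).ncard = (CE a).ncard + 2) : CE a ⊆ CE b := by
  obtain ⟨v, hv⟩ := Set.ncard_eq_one.mp hdist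
  have hne (i : ZMod n) (hi : i ≠ v) : a i = b i := by
    by_contra h
    exact hi (hv.subset h)
  intro i hi
  by_contra hib
  have hsub : CE b ⊆ (CE a \ {i}) ∪ {v - 1, v} := by
    intro j hj
    by_cases hjv : j = v
    · simp [hjv]
    by_cases hjv' : j + 1 = v
    · simp [← hjv']
    · refine Or.inl ⟨?_, fun hji => hib (hji ▸ hj)⟩
      simpa only [CE, Set.mem_ofPred_eq, hne j hjv, hne _ hjv'] using hj
  have h₁ := (Set.ncard_le_ncard hsub (Set.toFinite _)).trans (Set.ncard_union_le _ _)
  have h₂ := Set.ncard_insert_le (v - 1) {v}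
  have h₃ := Set.ncard_sdiff_singleton_add_one hi (Set.toFinite _)
  rw [Set.ncard_singleton] at h₂
  omega

theorem off_response_add (n k : ℕ) (hn : 0 < n) (hne : Even n) (hk : 1 ≤ k)
    (cOpt cOpt' cOff : ZMod n → Bool)
    (hstep : hamDist cOpt cOpt' = 1)
    (hadd : (CE cOpt').ncard = (CE cOpt).ncard + 2)
    (hsub : CE cOff ⊆ CE cOpt)
    (hcard : (CE cOff).ncard = min (2 * k) (CE cOpt).ncard) :
    ∃ cOff' : ZMod n → Bool,
      CE cOff' ⊆ CE cOpt' ∧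
      (CE cOff').ncard = min (2 * k) (CE cOpt').ncard ∧
      hamDist cOff cOff' + pot n cOpt' cOff' ≤ 1 + pot n cOpt cOff := by
  have : NeZero n := ⟨hn.ne'⟩
  rcases le_or_gt (2 * k) (CE cOpt).ncard with hle | hlt
  · refine ⟨cOff, hsub.trans (CE_subset_of_ncard_eq_add_two hstep hadd), by omega, ?_⟩
    rw [hamDist_self, zero_add, ← hstep]
    exact pot_le_hamDist_add_pot cOpt cOpt' cOff
  · have heven := even_ncard_CE cOpt
    have hmin : (CE cOpt').ncard = min (2 * k) (CE cOpt').ncard := by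
      obtain ⟨m, hm⟩ := heven
      omega
    have hCE : CE cOff = CE cOpt :=
      Set.eq_of_subset_of_ncard_le hsub (by omega) (Set.toFinite _)
    rcases eq_or_eq_not_of_CE_eq hCE with rfl | rfl
    · refine ⟨cOpt', subset_rfl, hmin, ?_⟩
      simp [hstep, pot, hamDist_self]
    · refine ⟨fun i => !cOpt' i, (CE_not cOpt').subset, by rwa [CE_not], ?_⟩
      simp [hamDist_not_not, hstep, pot, hamDist_not_right]
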